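/- arXiv:1601.00239 — 8 statements merged into one kernel-verified Lean document; each statement's English description precedes it below -/
import Mathlib

section
/- Let s : C → D and t : D → C form a Galois connection between partially ordered sets C and D, and let X be a partially ordered set. Then X is order-isomorphic to Fix(t∘s) if and only if there exist surjective maps l : C → X and r : D → X (not assumed monotone) such that for all c ∈ C and d ∈ D one has s c ≤ d ↔ l c ≤ r d. -/
/-- If `r` is surjective and `l`, `r` represent the relation `s c ≤ d`, then `l` induces on
`C` the same preorder as `s`. -/
theorem le_iff_le_of_surjective_of_forall_le_iff {C D X : Type*} [Preorder D] [Preorder X]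
    {s : C → D} {l : C → X} {r : D → X}
    (hr : Function.Surjective r) (h : ∀ c d, s c ≤ d ↔ l c ≤ r d) (a b : C) :
    l a ≤ l b ↔ s a ≤ s b := by
  constructor
  · intro hab
    exact (h a _).2 (hab.trans ((h b _).1 le_rfl))
  · intro hab
    obtain ⟨d, hd⟩ := hr (l b)
    rw [← hd, ← h]
    exact hab.trans ((h b d).2 hd.ge)

/-- A poset `X` is order-isomorphic to the fixed points `Fix (t ∘ s)`
of a Galois connection `s ⊣ t` iff there exist surjective maps `l : C → X`, `r : D → X`
with `s c ≤ d ↔ l c ≤ r d` for all `c`, `d`. -/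
theorem stmt0 {C D X : Type*} [PartialOrder C] [PartialOrder D] [PartialOrder X]
    (s : C → D) (t : D → C) (gc : GaloisConnection s t) :
    Nonempty (X ≃o {c : C // t (s c) = c}) ↔
      ∃ (l : C → X) (r : D → X), Function.Surjective l ∧ Function.Surjective r ∧
        ∀ (c : C) (d : D), s c ≤ d ↔ l c ≤ r d := by
  constructor
  · rintro ⟨e⟩
    refine ⟨fun c => e.symm ⟨t (s c), gc.u_l_u_eq_u (s c)⟩,
      fun d => e.symm ⟨t d, gc.u_l_u_eq_u d⟩, fun x => ?_, fun x => ?_, fun c d => ?_⟩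
    · exact ⟨e x, e.symm_apply_eq.2 (Subtype.ext (e x).2)⟩
    · exact ⟨s (e x), e.symm_apply_eq.2 (Subtype.ext (e x).2)⟩
    · rw [e.symm.le_iff_le, Subtype.mk_le_mk, ← gc.le_iff_le, gc.l_u_l_eq_l]
  · rintro ⟨l, r, hl, hr, h⟩
    have hle := le_iff_le_of_surjective_of_forall_le_iff hr h
    let f : {c : C // t (s c) = c} ↪o X := OrderEmbedding.ofMapLEIff (fun c => l c) fun a b => by
      rw [hle, gc.le_iff_le, b.2, Subtype.coe_le_coe]
    refine ⟨(RelIso.ofSurjective f fun x => ?_).symm⟩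
    obtain ⟨c, rfl⟩ := hl x
    have hs : s (t (s c)) = s c := gc.l_u_l_eq_l c
    exact ⟨⟨t (s c), congrArg t hs⟩, le_antisymm ((hle _ _).2 hs.le) ((hle _ _).2 hs.ge)⟩
end

section
/- Let s : C → D and t : D → C form a Galois connection between complete lattices C and D, and let X be a complete lattice. Then X is order-isomorphic to Fix(t∘s) if and only if there exist sets A and B, join-dense maps f : A → X and k : A → C, and meet-dense maps g : B → X and h : B → D, such that for all a ∈ A and b ∈ B one has s (k a) ≤ h b ↔ f a ≤ g b. -/
/-- A map `f : A → X` into a complete lattice is join-dense if every element of `X`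
is a supremum of images of a subset of `A`. -/
def JoinDense {A X : Type*} [CompleteLattice X] (f : A → X) : Prop :=
  ∀ x : X, ∃ S : Set A, x = ⨆ a ∈ S, f a

/-- A map `g : B → X` into a complete lattice is meet-dense if every element of `X`
is an infimum of images of a subset of `B`. -/
def MeetDense {B X : Type*} [CompleteLattice X] (g : B → X) : Prop :=
  ∀ x : X, ∃ S : Set B, x = ⨅ b ∈ S, g b

universe u

theorem JoinDense.le_iff {A X : Type*} [CompleteLattice X] {f : A → X} (hf : JoinDense f)
    {x y : X} : x ≤ y ↔ ∀ a, f a ≤ x → f a ≤ y := by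
  refine ⟨fun hxy a ha => ha.trans hxy, fun H => ?_⟩
  obtain ⟨S, rfl⟩ := hf x
  exact iSup₂_le fun a ha => H a (le_iSup₂ (f := fun a (_ : a ∈ S) => f a) a ha)

theorem MeetDense.le_iff {B X : Type*} [CompleteLattice X] {g : B → X} (hg : MeetDense g)
    {x y : X} : x ≤ y ↔ ∀ b, y ≤ g b → x ≤ g b := by
  refine ⟨fun hxy b hb => hxy.trans hb, fun H => ?_⟩
  obtain ⟨S, rfl⟩ := hg y
  exact le_iInf₂ fun b hb => H b (iInf₂_le (f := fun b (_ : b ∈ S) => g b) b hb)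

theorem Function.Surjective.joinDense {A X : Type*} [CompleteLattice X] {f : A → X}
    (hf : Function.Surjective f) : JoinDense f := fun x => by
  obtain ⟨a, rfl⟩ := hf x
  exact ⟨{a}, by simp⟩

theorem Function.Surjective.meetDense {B X : Type*} [CompleteLattice X] {g : B → X}
    (hg : Function.Surjective g) : MeetDense g := fun x => by
  obtain ⟨b, rfl⟩ := hg x
  exact ⟨{b}, by simp⟩

/-- A complete lattice `X` is order-isomorphic to the fixed points
`Fix (t ∘ s)` of a Galois connection `s ⊣ t` between complete lattices iff there
exist join-dense maps `f : A → X`, `k : A → C` and meet-dense maps `g : B → X`,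
`h : B → D` with `s (k a) ≤ h b ↔ f a ≤ g b`. -/
theorem stmt1 {C D X : Type u} [CompleteLattice C] [CompleteLattice D] [CompleteLattice X]
    (s : C → D) (t : D → C) (gc : GaloisConnection s t) :
    Nonempty (X ≃o {c : C // t (s c) = c}) ↔
      ∃ (A : Type u) (B : Type u) (f : A → X) (k : A → C) (g : B → X) (h : B → D),
        JoinDense f ∧ JoinDense k ∧ MeetDense g ∧ MeetDense h ∧
        ∀ (a : A) (b : B), s (k a) ≤ h b ↔ f a ≤ g b := by
  constructor
  · rintro ⟨e⟩
    refine ⟨C, D, fun c => e.symm ⟨t (s c), gc.u_l_u_eq_u (s c)⟩, id,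
      fun d => e.symm ⟨t d, gc.u_l_u_eq_u d⟩, id, ?_, Function.surjective_id.joinDense, ?_,
      Function.surjective_id.meetDense, fun c d => ?_⟩
    · refine Function.Surjective.joinDense fun x => ⟨(e x : C), ?_⟩
      simp only [(e x).2, Subtype.coe_eta, OrderIso.symm_apply_apply]
    · refine Function.Surjective.meetDense fun x => ⟨s (e x : C), ?_⟩
      simp only [(e x).2, Subtype.coe_eta, OrderIso.symm_apply_apply]
    · rw [e.symm.le_iff_le, Subtype.mk_le_mk, ← gc, gc.l_u_l_eq_l, id, id]
  · rintro ⟨A, B, f, k, g, h, hf, hk, hg, hh, H⟩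
    let T : X → {c : C // t (s c) = c} := fun x =>
      ⟨t (⨅ (b) (_ : x ≤ g b), h b), gc.u_l_u_eq_u _⟩
    have hT (a : A) (x : X) : k a ≤ (T x : C) ↔ f a ≤ x := by
      rw [hg.le_iff, ← gc, le_iInf₂_iff]
      exact forall₂_congr fun b _ => H a b
    have hle (x y : X) : T x ≤ T y ↔ x ≤ y := by
      rw [← Subtype.coe_le_coe, hk.le_iff, hf.le_iff]
      simp only [hT]
    refine ⟨RelIso.ofSurjective (OrderEmbedding.ofMapLEIff T hle) ?_⟩
    rintro ⟨c, hc⟩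
    refine ⟨⨆ (a) (_ : k a ≤ c), f a, Subtype.ext (le_antisymm ?_ ?_)⟩
    · refine hk.le_iff.2 fun a ha => ?_
      refine ((gc _ _).1 (hh.le_iff.2 ?_)).trans_eq hc
      intro b hb
      refine (H a b).2 (((hT a _).1 ha).trans (iSup₂_le fun a' ha' => ?_))
      exact (H a' b).1 ((gc.monotone_l ha').trans hb)
    · exact hk.le_iff.2 fun a ha =>
        (hT a _).2 (le_iSup₂ (f := fun a (_ : k a ≤ c) => f a) a ha)
end

section
/- Let s : C → D and t : D → C form a Galois connection between partially ordered sets C and D, let X be a partially ordered set, and let l : C → X and r : D → X be surjective maps such that for all c ∈ C, d ∈ D one has s c ≤ d ↔ l c ≤ r d. Then l is a left adjoint and r is a right adjoint: there exist maps l' : X → C and r' : X → D such that l ⊣ l' and r' ⊣ r are Galois connections. -/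
/-- if `s ⊣ t` is a Galois connection, `l : C → X` and `r : D → X`
are surjective and `s c ≤ d ↔ l c ≤ r d` for all `c`, `d`, then `l` is a left
adjoint and `r` is a right adjoint. -/
theorem stmt7 {C D X : Type*} [PartialOrder C] [PartialOrder D] [PartialOrder X]
    (s : C → D) (t : D → C) (gc : GaloisConnection s t)
    (l : C → X) (r : D → X) (hl : Function.Surjective l) (hr : Function.Surjective r)
    (h : ∀ (c : C) (d : D), s c ≤ d ↔ l c ≤ r d) :
    (∃ l' : X → C, GaloisConnection l l') ∧ (∃ r' : X → D, GaloisConnection r' r) := by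
  constructor
  · refine ⟨fun x => t (Function.surjInv hr x), fun c x => ?_⟩
    rw [← gc c, h, Function.surjInv_eq hr]
  · refine ⟨fun x => s (Function.surjInv hl x), fun x d => ?_⟩
    rw [h, Function.surjInv_eq hl]
end

section
/- Let s : C → D and t : D → C form a Galois connection between partially ordered sets C and D, let X be a partially ordered set, and let l : C → X and r : D → X be surjective maps such that for all c ∈ C, d ∈ D one has s c ≤ d ↔ l c ≤ r d. Then l (t d) = r d for every d ∈ D and r (s c) = l c for every c ∈ C. -/
/-- if `s ⊣ t` is a Galois connection, `l : C → X` and `r : D → X`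
are surjective and `s c ≤ d ↔ l c ≤ r d` for all `c`, `d`, then `l ∘ t = r` and
`r ∘ s = l`. -/
theorem stmt8 {C D X : Type*} [PartialOrder C] [PartialOrder D] [PartialOrder X]
    (s : C → D) (t : D → C) (gc : GaloisConnection s t)
    (l : C → X) (r : D → X) (hl : Function.Surjective l) (hr : Function.Surjective r)
    (h : ∀ (c : C) (d : D), s c ≤ d ↔ l c ≤ r d) :
    (∀ d : D, l (t d) = r d) ∧ (∀ c : C, r (s c) = l c) := by
  constructor
  · intro d
    obtain ⟨c, hc⟩ := hl (r d)
    obtain ⟨d', hd'⟩ := hr (l (t d))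
    have hcd : c ≤ t d := (gc c d).1 ((h c d).2 hc.le)
    refine le_antisymm ((h _ _).1 (gc.l_u_le d)) ?_
    rw [← hc, ← hd']
    exact (h _ _).1 ((gc.monotone_l hcd).trans ((h _ _).2 hd'.ge))
  · intro c
    obtain ⟨d, hd⟩ := hr (l c)
    obtain ⟨c', hc'⟩ := hl (r (s c))
    refine le_antisymm ?_ ((h _ _).1 le_rfl)
    rw [← hd, ← hc']
    exact (h _ _).1 (((h _ _).2 hc'.le).trans ((h _ _).2 hd.ge))
end

section
/- Let s : C → D and t : D → C form a Galois connection between complete lattices C and D, let X be a complete lattice, let A and B be sets, let f : A → X and k : A → C be join-dense maps, and let g : B → X and h : B → D be meet-dense maps such that s (k a) ≤ h b ↔ f a ≤ g b for all a ∈ A, b ∈ B. Define l : C → X by l c = ⨆ a ∈ {a | k a ≤ c}, f a and r : D → X by r d = ⨅ b ∈ {b | d ≤ h b}, g b. Then l (k a) = f a and r (h b) = g b for all a, b, the maps l and r are surjective, and s c ≤ d ↔ l c ≤ r d for all c ∈ C, d ∈ D. -/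
theorem JoinDense.le_of_forall {A X : Type*} [CompleteLattice X] {f : A → X}
    (hf : JoinDense f) {x y : X} (H : ∀ a, f a ≤ x → f a ≤ y) : x ≤ y := by
  obtain ⟨S, rfl⟩ := hf x
  exact iSup₂_le fun a ha => H a (le_iSup₂ (f := fun a (_ : a ∈ S) => f a) a ha)

theorem MeetDense.le_of_forall {B X : Type*} [CompleteLattice X] {g : B → X}
    (hg : MeetDense g) {x y : X} (H : ∀ b, y ≤ g b → x ≤ g b) : x ≤ y := by
  obtain ⟨S, rfl⟩ := hg y
  exact le_iInf₂ fun b hb => H b (iInf₂_le (f := fun b (_ : b ∈ S) => g b) b hb)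

theorem JoinDense.iSup_eq {A X : Type*} [CompleteLattice X] {f : A → X}
    (hf : JoinDense f) (x : X) : ⨆ a ∈ {a | f a ≤ x}, f a = x :=
  le_antisymm (iSup₂_le fun _ ha => ha) <| hf.le_of_forall fun a ha =>
    le_iSup₂ (f := fun a (_ : a ∈ {a | f a ≤ x}) => f a) a ha

theorem MeetDense.iInf_eq {B X : Type*} [CompleteLattice X] {g : B → X}
    (hg : MeetDense g) (x : X) : ⨅ b ∈ {b | x ≤ g b}, g b = x :=
  le_antisymm (hg.le_of_forall fun b hb =>
    iInf₂_le (f := fun b (_ : b ∈ {b | x ≤ g b}) => g b) b hb) (le_iInf₂ fun _ hb => hb)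

/-- given a Galois connection `s ⊣ t` between complete lattices,
join-dense maps `f : A → X`, `k : A → C` and meet-dense maps `g : B → X`,
`h : B → D` with `s (k a) ≤ h b ↔ f a ≤ g b`, the pointwise Kan extensions
`l c = ⨆ a ∈ {a | k a ≤ c}, f a` and `r d = ⨅ b ∈ {b | d ≤ h b}, g b` satisfy
`l (k a) = f a`, `r (h b) = g b`, are surjective, and `s c ≤ d ↔ l c ≤ r d`. -/
theorem stmt9 {C D X A B : Type*}
    [CompleteLattice C] [CompleteLattice D] [CompleteLattice X]
    (s : C → D) (t : D → C) (gc : GaloisConnection s t)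
    (f : A → X) (k : A → C) (g : B → X) (h : B → D)
    (hf : JoinDense f) (hk : JoinDense k) (hg : MeetDense g) (hh : MeetDense h)
    (hcomp : ∀ (a : A) (b : B), s (k a) ≤ h b ↔ f a ≤ g b) :
    (∀ a : A, (⨆ a' ∈ {a' : A | k a' ≤ k a}, f a') = f a) ∧
    (∀ b : B, (⨅ b' ∈ {b' : B | h b ≤ h b'}, g b') = g b) ∧
    Function.Surjective (fun c : C => ⨆ a ∈ {a : A | k a ≤ c}, f a) ∧
    Function.Surjective (fun d : D => ⨅ b ∈ {b : B | d ≤ h b}, g b) ∧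
    (∀ (c : C) (d : D),
      s c ≤ d ↔ (⨆ a ∈ {a : A | k a ≤ c}, f a) ≤ ⨅ b ∈ {b : B | d ≤ h b}, g b) := by
  refine ⟨fun a => ?_, fun b => ?_, fun x => ?_, fun x => ?_, fun c d => ?_⟩
  · refine le_antisymm (iSup₂_le fun a' ha' => hg.le_of_forall fun b hb => ?_)
      (le_iSup₂ (f := fun a' (_ : a' ∈ {a' | k a' ≤ k a}) => f a') a le_rfl)
    exact (hcomp a' b).1 ((gc.monotone_l ha').trans ((hcomp a b).2 hb))
  · refine le_antisymm
      (iInf₂_le (f := fun b' (_ : b' ∈ {b' | h b ≤ h b'}) => g b') b le_rfl)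
      (le_iInf₂ fun b' hb' => hf.le_of_forall fun a ha => ?_)
    exact (hcomp a b').1 (((hcomp a b).2 ha).trans hb')
  · refine ⟨t (⨅ b ∈ {b | x ≤ g b}, h b), ?_⟩
    have key : ∀ a, k a ≤ t (⨅ b ∈ {b | x ≤ g b}, h b) ↔ f a ≤ x := fun a => by
      rw [← gc, le_iInf₂_iff]
      simp only [hcomp]
      exact ⟨fun H => hg.le_of_forall H, fun H b hb => H.trans hb⟩
    simp only [key]
    exact hf.iSup_eq x
  · refine ⟨s (⨆ a ∈ {a | f a ≤ x}, k a), ?_⟩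
    have key : ∀ b, s (⨆ a ∈ {a | f a ≤ x}, k a) ≤ h b ↔ x ≤ g b := fun b => by
      rw [gc, iSup₂_le_iff]
      simp only [← gc (k _), hcomp]
      exact ⟨fun H => hf.le_of_forall H, fun H a ha => le_trans ha H⟩
    simp only [key]
    exact hg.iInf_eq x
  · simp only [iSup₂_le_iff, le_iInf₂_iff, ← hcomp]
    refine ⟨fun H b hb a ha => (gc.monotone_l ha).trans (H.trans hb), fun H => ?_⟩
    exact hh.le_of_forall fun b hb => (gc _ _).2 <| hk.le_of_forall fun a ha =>
      (gc _ _).1 (H b hb a ha)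
end

section
/- Let φ : A → B → Prop be a relation between sets A and B. In the formal concept lattice Mφ: (1) for every a ∈ A the set φ↓ (φ↑ {a}) belongs to Mφ, and for every b ∈ B the set φ↓ {b} belongs to Mφ; (2) the map F : A → Mφ, F a = φ↓ (φ↑ {a}), is join-dense and the map G : B → Mφ, G b = φ↓ {b}, is meet-dense; (3) for all a ∈ A and b ∈ B one has φ a b ↔ F a ⊆ G b. -/
/-- `φ↑ U = {y | ∀ x ∈ U, φ x y}`. -/
def polarUp {A B : Type*} (φ : A → B → Prop) (U : Set A) : Set B := {y | ∀ x ∈ U, φ x y}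

/-- `φ↓ V = {x | ∀ y ∈ V, φ x y}`. -/
def polarDown {A B : Type*} (φ : A → B → Prop) (V : Set B) : Set A := {x | ∀ y ∈ V, φ x y}

theorem subset_polarDown_polarUp {A B : Type*} (φ : A → B → Prop) (U : Set A) :
    U ⊆ polarDown φ (polarUp φ U) :=
  fun _ hx _ hy => hy _ hx

theorem subset_polarUp_polarDown {A B : Type*} (φ : A → B → Prop) (V : Set B) :
    V ⊆ polarUp φ (polarDown φ V) :=
  fun _ hy _ hx => hx _ hy

theorem polarUp_anti {A B : Type*} (φ : A → B → Prop) {U U' : Set A} (h : U ⊆ U') :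
    polarUp φ U' ⊆ polarUp φ U :=
  fun _ hy _ hx => hy _ (h hx)

theorem polarDown_anti {A B : Type*} (φ : A → B → Prop) {V V' : Set B} (h : V ⊆ V') :
    polarDown φ V' ⊆ polarDown φ V :=
  fun _ hx _ hy => hx _ (h hy)

theorem polarDown_polarUp_polarDown {A B : Type*} (φ : A → B → Prop) (V : Set B) :
    polarDown φ (polarUp φ (polarDown φ V)) = polarDown φ V :=
  (polarDown_anti φ (subset_polarUp_polarDown φ V)).antisymm (subset_polarDown_polarUp φ _)

theorem polarDown_eq_iInter {A B : Type*} (φ : A → B → Prop) (V : Set B) :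
    polarDown φ V = ⋂ b ∈ V, polarDown φ {b} := by
  ext x
  simp [polarDown]

theorem iUnion_polarDown_polarUp_singleton {A B : Type*} (φ : A → B → Prop) {U : Set A}
    (hU : polarDown φ (polarUp φ U) = U) :
    ⋃ a ∈ U, polarDown φ (polarUp φ {a}) = U := by
  refine (Set.iUnion₂_subset fun a ha => ?_).antisymm fun a ha =>
    Set.mem_biUnion ha (subset_polarDown_polarUp φ {a} rfl)
  exact (polarDown_anti φ (polarUp_anti φ (Set.singleton_subset_iff.2 ha))).trans hU.subset

/-- in the formal concept lattice `Mφ` (whose meets are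
intersections and whose join of a family is `φ↓ (φ↑ (⋃ of the family))`):
(1) `φ↓ (φ↑ {a}) ∈ Mφ` and `φ↓ {b} ∈ Mφ`;
(2) `F a = φ↓ (φ↑ {a})` is join-dense and `G b = φ↓ {b}` is meet-dense;
(3) `φ a b ↔ F a ⊆ G b`. -/
theorem stmt10 {A B : Type*} (φ : A → B → Prop) :
    (∀ a : A, polarDown φ (polarUp φ {a}) ∈
      {U : Set A | polarDown φ (polarUp φ U) = U}) ∧
    (∀ b : B, polarDown φ {b} ∈ {U : Set A | polarDown φ (polarUp φ U) = U}) ∧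
    (∀ U ∈ {U : Set A | polarDown φ (polarUp φ U) = U},
      (∃ S : Set A,
        U = polarDown φ (polarUp φ (⋃ a ∈ S, polarDown φ (polarUp φ {a})))) ∧
      (∃ T : Set B, U = ⋂ b ∈ T, polarDown φ {b})) ∧
    (∀ (a : A) (b : B), φ a b ↔ polarDown φ (polarUp φ {a}) ⊆ polarDown φ {b}) := by
  refine ⟨fun a => polarDown_polarUp_polarDown φ _, fun b => polarDown_polarUp_polarDown φ _,
    fun U hU => ⟨⟨U, ?_⟩, polarUp φ U, ?_⟩, fun a b => ⟨fun h x hx y hy => ?_, fun h => ?_⟩⟩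
  · rw [iUnion_polarDown_polarUp_singleton φ hU]
    exact hU.symm
  · rw [← polarDown_eq_iInter]
    exact hU.symm
  · obtain rfl : y = b := hy
    exact hx y fun z hz => by rwa [Set.mem_singleton_iff.1 hz]
  · exact h (subset_polarDown_polarUp φ {a} rfl) b rfl
end

section
/- Let φ : A → B → Prop be a relation between sets A and B. In the object-oriented concept lattice Kφ: (1) for every b ∈ B the set φ₊ (φ⁺ {b}) belongs to Kφ, and for every a ∈ A the set {y | ¬ φ a y} belongs to Kφ; (2) the map F : B → Kφ, F b = φ₊ (φ⁺ {b}), is join-dense and the map G : A → Kφ, G a = {y | ¬ φ a y}, is meet-dense; (3) for all a ∈ A and b ∈ B one has ¬ φ a b ↔ F b ⊆ G a. -/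
/-- `φ⁺ V = {x | ∃ y ∈ V, φ x y}`. -/
def kanDia {A B : Type*} (φ : A → B → Prop) (V : Set B) : Set A := {x | ∃ y ∈ V, φ x y}

/-- `φ₊ U = {y | ∀ x, φ x y → x ∈ U}`. -/
def kanBox {A B : Type*} (φ : A → B → Prop) (U : Set A) : Set B := {y | ∀ x, φ x y → x ∈ U}

theorem gc_kanDia_kanBox {A B : Type*} (φ : A → B → Prop) :
    GaloisConnection (kanDia φ) (kanBox φ) := fun _ _ =>
  ⟨fun h y hy _ hx => h ⟨y, hy, hx⟩, fun h x ⟨_, hy, hx⟩ => h hy x hx⟩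

theorem notMem_kanDia_iff {A B : Type*} (φ : A → B → Prop) (a : A) (V : Set B) :
    a ∉ kanDia φ V ↔ V ⊆ {y | ¬ φ a y} :=
  ⟨fun h y hy ha => h ⟨y, hy, ha⟩, fun h ⟨_, hy, ha⟩ => h hy ha⟩

theorem kanBox_eq_iInter {A B : Type*} (φ : A → B → Prop) (U : Set A) :
    kanBox φ U = ⋂ a ∈ Uᶜ, {y : B | ¬ φ a y} := by
  ext y
  simp only [kanBox, Set.mem_iInter, Set.mem_ofPred_eq, Set.mem_compl_iff]
  exact forall_congr' fun _ => not_imp_not.symm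

theorem kanBox_kanDia_setOf_not {A B : Type*} (φ : A → B → Prop) (a : A) :
    kanBox φ (kanDia φ {y | ¬ φ a y}) = {y | ¬ φ a y} :=
  Set.Subset.antisymm
    (fun _ hy ha => (notMem_kanDia_iff φ a _).2 subset_rfl (hy a ha))
    ((gc_kanDia_kanBox φ).le_u_l _)

/-- in the object-oriented concept lattice `Kφ` (whose meets are
intersections and whose join of a family is `φ₊ (φ⁺ (⋃ of the family))`):
(1) `φ₊ (φ⁺ {b}) ∈ Kφ` and `{y | ¬ φ a y} ∈ Kφ`;
(2) `F b = φ₊ (φ⁺ {b})` is join-dense and `G a = {y | ¬ φ a y}` is meet-dense;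
(3) `¬ φ a b ↔ F b ⊆ G a`. -/
theorem stmt11 {A B : Type*} (φ : A → B → Prop) :
    (∀ b : B, kanBox φ (kanDia φ {b}) ∈
      {V : Set B | kanBox φ (kanDia φ V) = V}) ∧
    (∀ a : A, {y : B | ¬ φ a y} ∈ {V : Set B | kanBox φ (kanDia φ V) = V}) ∧
    (∀ V ∈ {V : Set B | kanBox φ (kanDia φ V) = V},
      (∃ S : Set B, V = kanBox φ (kanDia φ (⋃ b ∈ S, kanBox φ (kanDia φ {b})))) ∧
      (∃ T : Set A, V = ⋂ a ∈ T, {y : B | ¬ φ a y})) ∧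
    (∀ (a : A) (b : B), ¬ φ a b ↔ kanBox φ (kanDia φ {b}) ⊆ {y : B | ¬ φ a y}) := by
  have gc := gc_kanDia_kanBox φ
  refine ⟨fun b => gc.u_l_u_eq_u _, kanBox_kanDia_setOf_not φ, fun V hV => ⟨⟨V, ?_⟩, ?_⟩,
    fun a b => ⟨fun h => ?_, fun h => h (gc.le_u_l {b} rfl)⟩⟩
  · refine Set.Subset.antisymm (fun b hb => ?_) ?_
    · exact gc.le_u_l _ (Set.mem_biUnion hb (gc.le_u_l {b} rfl))
    · have hsub : ⋃ b ∈ V, kanBox φ (kanDia φ {b}) ⊆ V := Set.iUnion₂_subset fun b hb =>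
        (gc.monotone_u (gc.monotone_l (Set.singleton_subset_iff.2 hb))).trans hV.le
      exact (gc.monotone_u (gc.monotone_l hsub)).trans hV.le
  · exact ⟨(kanDia φ V)ᶜ, hV.symm.trans (kanBox_eq_iInter φ _)⟩
  · rw [← kanBox_kanDia_setOf_not φ a]
    exact gc.monotone_u (gc.monotone_l (Set.singleton_subset_iff.2 h))
end

section
/- Let f : A → B and g : B → C be monotone maps between preorders such that f and g are both dense and g has a right adjoint (there exists g' : C → B with g ⊣ g' a Galois connection). Then the composite g ∘ f : A → C is dense. -/
/-- A monotone map `f : A → B` between preorders is dense if every `y : B` is a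
supremum in `B` of the image under `f` of some subset of `A`. -/
def OrdDense {A B : Type*} [Preorder A] [Preorder B] (f : A → B) : Prop :=
  ∀ y : B, ∃ S : Set A, ∀ z : B, y ≤ z ↔ ∀ a ∈ S, f a ≤ z

/-- the composite of dense monotone maps is dense, provided the
second one is a left adjoint. -/
theorem stmt13 {A B C : Type*} [Preorder A] [Preorder B] [Preorder C]
    (f : A → B) (g : B → C) (hf : Monotone f) (hg : Monotone g)
    (hfd : OrdDense f) (hgd : OrdDense g)
    (hadj : ∃ g' : C → B, GaloisConnection g g') :
    OrdDense (g ∘ f) := by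
  obtain ⟨g', hadj⟩ := hadj
  choose S hS using hfd
  intro y
  obtain ⟨T, hT⟩ := hgd y
  refine ⟨⋃ b ∈ T, S b, fun z => ?_⟩
  simp only [hT z, Set.mem_iUnion]
  constructor
  · rintro h a ⟨b, hb, ha⟩
    exact (hadj _ z).2 ((hS b _).1 ((hadj b z).1 (h b hb)) a ha)
  · intro h b hb
    exact (hadj b z).2 ((hS b _).2 fun a ha => (hadj _ z).1 (h a ⟨b, hb, ha⟩))
end
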